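/- Let n be a positive integer and let q_0, q_1 : ℝ^n → ℝ be quadratic functions, i.e. q_j(x) = ⟨x, A_j x⟩ + ⟨b_j, x⟩ + c_j where A_j is a symmetric n×n real matrix, b_j ∈ ℝ^n, and c_j ∈ ℝ, for j = 0, 1. Assume the Slater condition: there exists x̄ ∈ ℝ^n with q_1(x̄) > 0. Then the implication (for all x ∈ ℝ^n, q_1(x) ≥ 0 implies q_0(x) ≥ 0) holds if and only if there exists a scalar λ ≥ 0 such that q_0(x) − λ q_1(x) ≥ 0 for all x ∈ ℝ^n. -/

import Mathlib

open scoped Matrix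

/-- A real quadratic polynomial with negative leading and positive constant coefficient has a
negative and a positive root. -/
theorem exists_neg_pos_roots {a b c : ℝ} (ha : a < 0) (hc : 0 < c) :
    ∃ r s : ℝ, r < 0 ∧ 0 < s ∧ a * r ^ 2 + b * r + c = 0 ∧ a * s ^ 2 + b * s + c = 0 ∧
      a * (r * s) = c := by
  have hac : a * c < 0 := mul_neg_of_neg_of_pos ha hc
  have hD : Real.sqrt (b ^ 2 - 4 * a * c) ^ 2 = b ^ 2 - 4 * a * c :=
    Real.sq_sqrt (by nlinarith [sq_nonneg b])
  have hlt : |b| < Real.sqrt (b ^ 2 - 4 * a * c) := by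
    refine Real.lt_sqrt_of_sq_lt ?_
    rw [sq_abs]
    linarith
  obtain ⟨h₁, h₂⟩ := abs_lt.1 hlt
  set d := Real.sqrt (b ^ 2 - 4 * a * c)
  have ha' : a ≠ 0 := ha.ne
  refine ⟨(-b + d) / (2 * a), (-b - d) / (2 * a), ?_, ?_, ?_, ?_, ?_⟩
  · exact div_neg_of_pos_of_neg (by linarith) (by linarith)
  · exact div_pos_of_neg_of_neg (by linarith) (by linarith)
  · field_simp
    linear_combination hD
  · field_simp
    linear_combination hD
  · field_simp
    linear_combination -hD

/-- A real quadratic polynomial that is nonnegative on `[0, ∞)` has a nonnegative leading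
coefficient. -/
theorem leadingCoeff_nonneg_of_quadratic_nonneg {a b c : ℝ}
    (h : ∀ t : ℝ, 0 ≤ t → 0 ≤ a * t ^ 2 + b * t + c) : 0 ≤ a := by
  by_contra! ha
  have hu : 0 ≤ (|b| + |c|) / -a := div_nonneg (by positivity) (by linarith)
  have hau : a * ((|b| + |c|) / -a) = -(|b| + |c|) := by
    rw [div_neg, mul_neg, mul_div_cancel₀ _ ha.ne]
  set u := (|b| + |c|) / -a
  have ht := h (1 + u) (by linarith)
  have hb : b * (1 + u) ≤ |b| * (1 + u) :=
    mul_le_mul_of_nonneg_right (le_abs_self b) (by linarith)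
  have hc : c ≤ |c| * (1 + u) := by nlinarith [le_abs_self c, abs_nonneg c]
  have key : a * (1 + u) ^ 2 + |b| * (1 + u) + |c| * (1 + u) = a * (1 + u) := by
    linear_combination (1 + u) * hau
  nlinarith

namespace QuadraticMap

variable {V : Type*} [AddCommGroup V] [Module ℝ V]

theorem map_add_smul_eq (Q : QuadraticForm ℝ V) (v w : V) (t : ℝ) :
    Q (v + t • w) = Q w * t ^ 2 + polar Q v w * t + Q v := by
  rw [QuadraticMap.map_add Q, QuadraticMap.map_smul, polar_smul_right]
  simp only [smul_eq_mul]
  ring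

/-- The homogeneous S-lemma. -/
theorem exists_nonneg_sub_mul_nonneg {F G : QuadraticForm ℝ V}
    (h : ∀ v, 0 ≤ G v → 0 ≤ F v) (hG : ∃ v, 0 < G v) :
    ∃ c : ℝ, 0 ≤ c ∧ ∀ v, 0 ≤ F v - c * G v := by
  have cross : ∀ v w, 0 < G v → G w < 0 → F v * G w ≤ F w * G v := by
    intro v w hv hw
    obtain ⟨r, s, hr, hs, hGr, hGs, hrs⟩ := exists_neg_pos_roots (b := polar G v w) hw hv
    have hFr := h (v + r • w) (by rw [map_add_smul_eq, hGr])
    have hFs := h (v + s • w) (by rw [map_add_smul_eq, hGs])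
    rw [map_add_smul_eq] at hFr hFs
    have hle : 0 ≤ (s - r) * (F v - r * s * F w) := by
      nlinarith [mul_nonneg hs.le hFr, mul_nonneg (neg_nonneg.2 hr.le) hFs]
    have hle' : 0 ≤ F v - r * s * F w := nonneg_of_mul_nonneg_right hle (by linarith)
    rw [← hrs]
    nlinarith [mul_nonneg hle' (neg_nonneg.2 hw.le)]
  obtain ⟨v₀, hv₀⟩ := hG
  let S : Set ℝ := {x | ∃ v, 0 < G v ∧ F v / G v = x}
  have hne : S.Nonempty := ⟨_, v₀, hv₀, rfl⟩
  have hlb : 0 ∈ lowerBounds S := by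
    rintro _ ⟨v, hv, rfl⟩
    exact div_nonneg (h v hv.le) hv.le
  refine ⟨sInf S, le_csInf hne hlb, fun v ↦ ?_⟩
  rcases lt_trichotomy (G v) 0 with hv | hv | hv
  · have hle : F v / G v ≤ sInf S := by
      refine le_csInf hne ?_
      rintro _ ⟨w, hw, rfl⟩
      rw [div_le_iff_of_neg hv, div_mul_eq_mul_div, div_le_iff₀ hw]
      exact cross w v hw hv
    rw [div_le_iff_of_neg hv] at hle
    linarith
  · simpa [hv] using h v hv.ge
  · have hle : sInf S ≤ F v / G v := csInf_le ⟨0, hlb⟩ ⟨v, hv, rfl⟩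
    rw [le_div_iff₀ hv] at hle
    linarith

/-- The homogenization of the quadratic function `x ↦ Q x + b x + c`. -/
noncomputable def homogenization (Q : QuadraticForm ℝ V) (b : V →ₗ[ℝ] ℝ) (c : ℝ) :
    QuadraticForm ℝ (V × ℝ) :=
  Q.comp (LinearMap.fst ℝ V ℝ) +
    linMulLin (b ∘ₗ LinearMap.fst ℝ V ℝ) (LinearMap.snd ℝ V ℝ) +
    c • QuadraticMap.sq.comp (LinearMap.snd ℝ V ℝ)

theorem homogenization_apply (Q : QuadraticForm ℝ V) (b : V →ₗ[ℝ] ℝ) (c : ℝ) (x : V) (s : ℝ) :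
    homogenization Q b c (x, s) = Q x + b x * s + c * (s * s) := by
  simp [homogenization]

/-- The homogenization at a point off the hyperplane at infinity. -/
theorem homogenization_apply_of_ne_zero (Q : QuadraticForm ℝ V) (b : V →ₗ[ℝ] ℝ) (c : ℝ) (x : V)
    {s : ℝ} (hs : s ≠ 0) :
    homogenization Q b c (x, s) = s ^ 2 * (Q (s⁻¹ • x) + b (s⁻¹ • x) + c) := by
  rw [homogenization_apply, QuadraticMap.map_smul, map_smul, smul_eq_mul, smul_eq_mul]
  field_simp

/-- The inhomogeneous S-lemma on a real vector space. -/
theorem exists_nonneg_sub_mul_nonneg_of_affine {Q₀ Q₁ : QuadraticForm ℝ V} {b₀ b₁ : V →ₗ[ℝ] ℝ}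
    {c₀ c₁ : ℝ} (h : ∀ x, 0 ≤ Q₁ x + b₁ x + c₁ → 0 ≤ Q₀ x + b₀ x + c₀)
    (slater : ∃ x, 0 < Q₁ x + b₁ x + c₁) :
    ∃ c : ℝ, 0 ≤ c ∧ ∀ x, 0 ≤ Q₀ x + b₀ x + c₀ - c * (Q₁ x + b₁ x + c₁) := by
  obtain ⟨z, hz⟩ := slater
  have expand : ∀ (Q : QuadraticForm ℝ V) (b : V →ₗ[ℝ] ℝ) (c : ℝ) (x : V) (t : ℝ),
      Q (z + t • x) + b (z + t • x) + c =
        Q x * t ^ 2 + (polar Q z x + b x) * t + (Q z + b z + c) := by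
    intro Q b c x t
    rw [map_add_smul_eq, map_add, map_smul, smul_eq_mul]
    ring
  have recession_of_slope : ∀ x, 0 ≤ Q₁ x → 0 ≤ polar Q₁ z x + b₁ x → 0 ≤ Q₀ x := by
    intro x hx hslope
    refine leadingCoeff_nonneg_of_quadratic_nonneg (b := polar Q₀ z x + b₀ x)
      (c := Q₀ z + b₀ z + c₀) fun t ht ↦ ?_
    rw [← expand]
    refine h _ ?_
    rw [expand]
    positivity
  have recession : ∀ x, 0 ≤ Q₁ x → 0 ≤ Q₀ x := by
    intro x hx
    rcases le_total 0 (polar Q₁ z x + b₁ x) with hs | hs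
    · exact recession_of_slope x hx hs
    · rw [← QuadraticMap.map_neg]
      refine recession_of_slope (-x) (by rwa [QuadraticMap.map_neg]) ?_
      rw [polar_neg_right, map_neg]
      linarith
  have homogeneous : ∀ p, 0 ≤ homogenization Q₁ b₁ c₁ p → 0 ≤ homogenization Q₀ b₀ c₀ p := by
    rintro ⟨x, s⟩ hx
    rcases eq_or_ne s 0 with rfl | hs
    · simp only [homogenization_apply, mul_zero, add_zero] at hx ⊢
      exact recession x hx
    · have hs2 : 0 < s ^ 2 := by positivity
      rw [homogenization_apply_of_ne_zero _ _ _ _ hs] at hx ⊢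
      exact mul_nonneg hs2.le (h _ (nonneg_of_mul_nonneg_right hx hs2))
  obtain ⟨c, hc, hle⟩ := exists_nonneg_sub_mul_nonneg homogeneous
    ⟨(z, 1), by simpa [homogenization_apply] using hz⟩
  exact ⟨c, hc, fun x ↦ by simpa [homogenization_apply] using hle (x, 1)⟩

end QuadraticMap

/-- Yakubovich's S-lemma (exact S-procedure for two quadratic functions).
A quadratic function is `x ↦ ⟨x, A x⟩ + ⟨b, x⟩ + c` with `A` symmetric.
Under the Slater condition `∃ xbar, q1 xbar > 0`, the implication
`q1 x ≥ 0 → q0 x ≥ 0` holds for all `x` iff there is `λ ≥ 0` with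
`q0 - λ q1 ≥ 0` everywhere. -/
theorem s_lemma (n : ℕ) (hn : 0 < n)
    (A0 A1 : Matrix (Fin n) (Fin n) ℝ) (b0 b1 : Fin n → ℝ) (c0 c1 : ℝ)
    (hA0 : A0.IsSymm) (hA1 : A1.IsSymm)
    (q0 q1 : (Fin n → ℝ) → ℝ)
    (hq0 : ∀ x, q0 x = x ⬝ᵥ (A0 *ᵥ x) + b0 ⬝ᵥ x + c0)
    (hq1 : ∀ x, q1 x = x ⬝ᵥ (A1 *ᵥ x) + b1 ⬝ᵥ x + c1)
    (slater : ∃ xbar : Fin n → ℝ, 0 < q1 xbar) :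
    (∀ x : Fin n → ℝ, 0 ≤ q1 x → 0 ≤ q0 x) ↔
      (∃ lam : ℝ, 0 ≤ lam ∧ ∀ x : Fin n → ℝ, 0 ≤ q0 x - lam * q1 x) := by
  constructor
  · intro h
    have eval : ∀ (A : Matrix (Fin n) (Fin n) ℝ) (b x : Fin n → ℝ) (c : ℝ),
        x ⬝ᵥ (A *ᵥ x) + b ⬝ᵥ x + c =
          A.toQuadraticForm' x + dotProductBilin ℝ ℝ b x + c := by
      intro A b x c
      rw [Matrix.toQuadraticForm', LinearMap.BilinMap.toQuadraticMap_apply,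
        Matrix.toLinearMap₂'_apply']
      rfl
    simp only [hq0, hq1, eval] at h slater ⊢
    exact QuadraticMap.exists_nonneg_sub_mul_nonneg_of_affine h slater
  · rintro ⟨lam, hlam, hle⟩ x hx
    linarith [hle x, mul_nonneg hlam hx]
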